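/- For every n ≥ 3 there exist an (n-1)-dimensional convex body C ⊂ e_n^⊥ and a convex body A in the canal class K_C (i.e., P_{e_n^⊥}(A) = C, A full-dimensional) such that H^n(A)/H^{n-1}(∂A) > 1/(2(n-1)) = lim_{h→∞} H^n(C_h)/H^{n-1}(∂C_h), where C_h is the cylinder of height h over C. Concretely one may take C the unit cube [0,1]^{n-1} × {0} and A = cl((C + h[0,e_n]) \ S) with S = conv{0, e_1/3, ..., e_{n-1}/3, h·e_n} for suitable large h. -/

import Mathlib

open MeasureTheory Set Pointwise Filter
open scoped ENNReal RealInnerProductSpace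
noncomputable section

/-- Orthogonal projection onto the hyperplane `u^⊥` (for a unit vector `u`),
applied to a set. -/
def projPerp {n : ℕ} (u : EuclideanSpace ℝ (Fin n)) (S : Set (EuclideanSpace ℝ (Fin n))) :
    Set (EuclideanSpace ℝ (Fin n)) := (fun x => x - ⟪x, u⟫ • u) '' S

abbrev EE (k : ℕ) := EuclideanSpace ℝ (Fin k)

def cbox {k : ℕ} (l : Fin k → ℝ) : Set (EE k) := {x | ∀ i, 0 ≤ x i ∧ x i ≤ l i}
def obox {k : ℕ} (l : Fin k → ℝ) : Set (EE k) := {x | ∀ i, 0 < x i ∧ x i < l i}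

lemma cbox_closed {k : ℕ} (l : Fin k → ℝ) : IsClosed (cbox l) := by
  simp only [cbox, ofPred_forall]
  refine isClosed_iInter fun i => ?_
  have h1 : IsClosed {x : EE k | 0 ≤ x i} := isClosed_le (by fun_prop) (by fun_prop)
  have h2 : IsClosed {x : EE k | x i ≤ l i} := isClosed_le (by fun_prop) (by fun_prop)
  exact h1.inter h2

lemma obox_open {k : ℕ} (l : Fin k → ℝ) : IsOpen (obox l) := by
  simp only [obox, ofPred_forall]
  refine isOpen_iInter_of_finite fun i => ?_
  have h1 : IsOpen {x : EE k | 0 < x i} := isOpen_lt (by fun_prop) (by fun_prop)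
  have h2 : IsOpen {x : EE k | x i < l i} := isOpen_lt (by fun_prop) (by fun_prop)
  exact h1.inter h2

lemma cbox_compact {k : ℕ} (l : Fin k → ℝ) : IsCompact (cbox l) := by
  have h : cbox l = (EuclideanSpace.equiv (Fin k) ℝ).toHomeomorph ⁻¹' (Icc 0 l) := by
    ext x
    simp [cbox, Pi.le_def, forall_and]
  rw [h, Homeomorph.isCompact_preimage]
  exact isCompact_Icc

lemma cbox_convex {k : ℕ} (l : Fin k → ℝ) : Convex ℝ (cbox l) := by
  intro x hx y hy a b ha hb hab i
  have h1 := hx i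
  have h2 := hy i
  simp only [PiLp.add_apply, PiLp.smul_apply, smul_eq_mul]
  constructor
  · exact add_nonneg (mul_nonneg ha h1.1) (mul_nonneg hb h2.1)
  · calc a * x i + b * y i ≤ a * l i + b * l i := by gcongr; exact h1.2; exact h2.2
      _ = l i := by rw [← add_mul, hab, one_mul]

lemma haus (k : ℕ) : ∃ q : ℝ, 0 < q ∧ ((∀ l : Fin k → ℝ, (∀ i, 0 ≤ l i) →
    (μH[(k : ℝ)] : Measure (EE k)) (cbox l) = ENNReal.ofReal (q * ∏ i, l i)) ∧
    (∀ l : Fin k → ℝ, (∀ i, 0 ≤ l i) →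
    (μH[(k : ℝ)] : Measure (EE k)) (obox l) = ENNReal.ofReal (q * ∏ i, l i))) := by
  have inst : (μH[(k : ℝ)] : Measure (EE k)).IsAddHaarMeasure := by
    have := isAddHaarMeasure_hausdorffMeasure (E := EE k)
    simpa using this
  obtain ⟨c, hc0, hct, hc⟩ : ∃ c : ℝ≥0∞, c ≠ 0 ∧ c ≠ ∞ ∧
      (μH[(k : ℝ)] : Measure (EE k)) = c • volume :=
    ⟨_, ENNReal.coe_ne_zero.2 (Measure.addHaarScalarFactor_pos_of_isAddHaarMeasure
      (μH[(k : ℝ)] : Measure (EE k)) volume).ne', ENNReal.coe_ne_top,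
      Measure.isAddLeftInvariant_eq_smul _ _⟩
  refine ⟨c.toReal, ENNReal.toReal_pos hc0 hct, fun l hl => ?_, fun l hl => ?_⟩
  · have h : cbox l = (WithLp.ofLp : EE k → (Fin k → ℝ)) ⁻¹' (Icc 0 l) := by
      ext x
      simp [cbox, Pi.le_def, forall_and]
    rw [hc, Measure.smul_apply, h,
      (PiLp.volume_preserving_ofLp (Fin k)).measure_preimage measurableSet_Icc.nullMeasurableSet,
      Real.volume_Icc_pi, ENNReal.ofReal_mul ENNReal.toReal_nonneg, ENNReal.ofReal_toReal hct,
      ENNReal.ofReal_prod_of_nonneg (fun i _ => hl i)]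
    simp
  · have h : obox l = (WithLp.ofLp : EE k → (Fin k → ℝ)) ⁻¹' (pi univ fun i => Ioo 0 (l i)) := by
      ext x
      simp [obox]
    rw [hc, Measure.smul_apply, h,
      (PiLp.volume_preserving_ofLp (Fin k)).measure_preimage
        (MeasurableSet.univ_pi fun i => measurableSet_Ioo).nullMeasurableSet,
      Real.volume_pi_Ioo, ENNReal.ofReal_mul ENNReal.toReal_nonneg, ENNReal.ofReal_toReal hct,
      ENNReal.ofReal_prod_of_nonneg (fun i _ => hl i)]
    simp

def ins {k : ℕ} (i : Fin (k+1)) (c : ℝ) (y : EE k) : EE (k+1) :=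
  WithLp.toLp 2 (Fin.insertNth i c (fun j => y j) : Fin (k+1) → ℝ)

@[simp] lemma ins_same {k : ℕ} (i : Fin (k+1)) (c : ℝ) (y : EE k) : ins i c y i = c := by
  simp [ins]
@[simp] lemma ins_succAbove {k : ℕ} (i : Fin (k+1)) (c : ℝ) (y : EE k) (j : Fin k) :
    ins i c y (i.succAbove j) = y j := by
  simp [ins]

def res {k : ℕ} (i : Fin (k+1)) (x : EE (k+1)) : EE k := WithLp.toLp 2 fun j => x (i.succAbove j)

@[simp] lemma res_apply {k : ℕ} (i : Fin (k+1)) (x : EE (k+1)) (j : Fin k) :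
    res i x j = x (i.succAbove j) := rfl

lemma ins_res {k : ℕ} (i : Fin (k+1)) (x : EE (k+1)) : ins i (x i) (res i x) = x := by
  ext j
  rcases Fin.eq_self_or_eq_succAbove i j with rfl | ⟨j, rfl⟩ <;> simp

lemma ins_isometry {k : ℕ} (i : Fin (k+1)) (c : ℝ) : Isometry (ins i c : EE k → EE (k+1)) := by
  refine Isometry.of_dist_eq fun x y => ?_
  rw [EuclideanSpace.dist_eq, EuclideanSpace.dist_eq, Fin.sum_univ_succAbove _ i]
  simp

lemma facet_measure {k : ℕ} (i : Fin (k+1)) (c : ℝ) (S : Set (EE k)) :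
    (μH[(k : ℝ)] : Measure (EE (k+1))) (ins i c '' S) = μH[(k : ℝ)] S :=
  (ins_isometry i c).hausdorffMeasure_image (Or.inl (by positivity)) S

lemma frontier_cbox_sub {k : ℕ} (l : Fin (k+1) → ℝ) :
    frontier (cbox l) ⊆ ⋃ p : Fin (k+1) × Bool,
      ins p.1 (if p.2 then l p.1 else 0) '' cbox (fun j => l (p.1.succAbove j)) := by
  intro x hx
  have hxA : x ∈ cbox l := (cbox_closed l).frontier_subset hx
  have hni : x ∉ interior (cbox l) := hx.2
  have : ¬ x ∈ obox l := fun h => hni (mem_interior.2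
    ⟨obox l, fun y hy i => ⟨(hy i).1.le, (hy i).2.le⟩, obox_open l, h⟩)
  simp only [obox, mem_ofPred_eq, not_forall, not_and_or, not_lt] at this
  obtain ⟨i, hi⟩ := this
  have hres : res i x ∈ cbox (fun j => l (i.succAbove j)) := fun j => hxA _
  rcases hi with hi | hi
  · have : x i = 0 := le_antisymm hi (hxA i).1
    refine mem_iUnion.2 ⟨(i, false), res i x, hres, ?_⟩
    conv_rhs => rw [← ins_res i x, this]
    simp
  · have : x i = l i := le_antisymm (hxA i).2 hi
    refine mem_iUnion.2 ⟨(i, true), res i x, hres, ?_⟩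
    conv_rhs => rw [← ins_res i x, this]
    simp

lemma sub_frontier_cbox {k : ℕ} (l : Fin (k+1) → ℝ) (hl : ∀ i, 0 < l i) (p : Fin (k+1) × Bool) :
     ins p.1 (if p.2 then l p.1 else 0) '' obox (fun j => l (p.1.succAbove j))
      ⊆ frontier (cbox l) := by
  rintro _ ⟨y, hy, rfl⟩
  set x := ins p.1 (if p.2 then l p.1 else 0) y with hx
  refine ⟨subset_closure ?_, ?_⟩
  · intro j
    rcases Fin.eq_self_or_eq_succAbove p.1 j with rfl | ⟨j, rfl⟩
    · rw [hx, ins_same]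
      split_ifs
      · exact ⟨(hl _).le, le_rfl⟩
      · exact ⟨le_rfl, (hl _).le⟩
    · rw [hx, ins_succAbove]
      exact ⟨(hy j).1.le, (hy j).2.le⟩
  · intro hint
    have hc : Continuous (fun s : ℝ => x + s • (EuclideanSpace.single p.1 (1:ℝ) : EE (k+1))) := by
      fun_prop
    have h0 : ∀ᶠ s : ℝ in nhds 0,
        x + s • (EuclideanSpace.single p.1 (1:ℝ) : EE (k+1)) ∈ cbox l := by
      have := hc.continuousAt (x := 0)
      refine this.eventually_mem ?_
      simpa using mem_interior_iff_mem_nhds.1 hint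
    rw [Metric.eventually_nhds_iff] at h0
    obtain ⟨ε, hε, h0⟩ := h0
    have h1 := h0 (y := ε/2) (by simp [abs_of_pos hε]; linarith) p.1
    have h2 := h0 (y := -(ε/2)) (by simp [abs_of_pos hε]; linarith) p.1
    simp [hx] at h1 h2
    split_ifs at h1 h2 <;> linarith [h1.1, h2.1, h1.2, h2.2]

lemma frontier_cbox_measure {k : ℕ} (l : Fin (k+1) → ℝ) (hl : ∀ i, 0 < l i) (q : ℝ) (hq : 0 < q)
    (h1 : ∀ l : Fin k → ℝ, (∀ i, 0 ≤ l i) →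
      (μH[(k : ℝ)] : Measure (EE k)) (cbox l) = ENNReal.ofReal (q * ∏ i, l i))
    (h2 : ∀ l : Fin k → ℝ, (∀ i, 0 ≤ l i) →
      (μH[(k : ℝ)] : Measure (EE k)) (obox l) = ENNReal.ofReal (q * ∏ i, l i)) :
    (μH[(k : ℝ)] : Measure (EE (k+1))) (frontier (cbox l)) =
      ENNReal.ofReal (∑ i : Fin (k+1), 2 * (q * ∏ j, l (i.succAbove j))) := by
  have hsum : ENNReal.ofReal (∑ i : Fin (k+1), 2 * (q * ∏ j, l (i.succAbove j))) =
      ∑ p : Fin (k+1) × Bool, ENNReal.ofReal (q * ∏ j, l (p.1.succAbove j)) := by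
    rw [← ENNReal.ofReal_sum_of_nonneg]
    · congr 1
      rw [Fintype.sum_prod_type]
      simp [two_mul]
    · intro p _
      exact mul_nonneg hq.le (Finset.prod_nonneg fun j _ => (hl _).le)
  rw [hsum]
  apply le_antisymm
  · refine (measure_mono (frontier_cbox_sub l)).trans ((measure_iUnion_fintype_le _ _).trans ?_)
    refine Finset.sum_le_sum fun p _ => ?_
    rw [facet_measure, h1 _ (fun j => (hl _).le)]
  · calc _ = ∑ p : Fin (k+1) × Bool, (μH[(k : ℝ)] : Measure (EE (k+1)))
          (ins p.1 (if p.2 then l p.1 else 0) '' obox (fun j => l (p.1.succAbove j))) := by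
          refine Finset.sum_congr rfl fun p _ => ?_
          rw [facet_measure, h2 _ (fun j => (hl _).le)]
      _ = (μH[(k : ℝ)] : Measure (EE (k+1))) (⋃ p : Fin (k+1) × Bool,
          (ins p.1 (if p.2 then l p.1 else 0) '' obox (fun j => l (p.1.succAbove j)))) := by
          rw [measure_iUnion, tsum_fintype]
          · rintro ⟨i, b⟩ ⟨i', b'⟩ hne
            rw [Function.onFun, Set.disjoint_left]
            rintro _ ⟨y, hy, rfl⟩ ⟨y', hy', he⟩
            simp only at hy hy' he
            by_cases hii : i = i'
            · subst hii
              have := congrArg (fun x : EE (k+1) => x i) he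
              simp only [ins_same] at this
              have hp := hl i
              cases b <;> cases b' <;> simp at this hne <;> linarith
            · obtain ⟨j, rfl⟩ := Fin.exists_succAbove_eq hii
              have := congrArg (fun x : EE (k+1) => x (i'.succAbove j)) he
              simp only [ins_same, ins_succAbove] at this
              have h3 := hy' j
              rw [this] at h3
              split_ifs at h3 <;> linarith [h3.1, h3.2]
          · rintro ⟨i, b⟩
            exact (ins_isometry i _).isClosedEmbedding.measurableEmbedding.measurableSet_image.2
              (obox_open _).measurableSet
      _ ≤ _ := measure_mono (iUnion_subset fun p => sub_frontier_cbox l hl p)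

def Lk (k : ℕ) (t h : ℝ) : Fin (k+1) → ℝ := fun i => if i = Fin.last k then h else t

lemma Lk_prod (k : ℕ) (t h : ℝ) : ∏ i, Lk k t h i = t ^ k * h := by
  rw [Fin.prod_univ_castSucc]
  simp [Lk, Fin.castSucc_ne_last]

lemma Lk_pos (k : ℕ) {t h : ℝ} (ht : 0 < t) (hh : 0 < h) (i) : 0 < Lk k t h i := by
  unfold Lk; split_ifs <;> assumption

lemma succAbove_zero_last (m : ℕ) : (0 : Fin (m+3)).succAbove (Fin.last (m+1)) = Fin.last (m+2) := by
  simp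
lemma succAbove_one_last (m : ℕ) : (1 : Fin (m+3)).succAbove (Fin.last (m+1)) = Fin.last (m+2) := by
  rw [Fin.succAbove_of_le_castSucc]
  · simp
  · simp [Fin.le_def]
lemma succAbove_one_zero (m : ℕ) : (1 : Fin (m+3)).succAbove (0 : Fin (m+2)) = 0 := by
  rw [Fin.succAbove_of_castSucc_lt]
  · simp
  · simp
lemma succAbove_zero_zero (m : ℕ) : (0 : Fin (m+3)).succAbove (0 : Fin (m+2)) = 1 := by
  simp

lemma Lk_zero (m : ℕ) (t h : ℝ) : (fun j => Lk (m+2) t h ((0 : Fin (m+3)).succAbove j)) = Lk (m+1) t h := by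
  ext j
  unfold Lk
  rw [← succAbove_zero_last]
  simp only [Fin.succAbove_right_inj]
lemma Lk_one (m : ℕ) (t h : ℝ) : (fun j => Lk (m+2) t h ((1 : Fin (m+3)).succAbove j)) = Lk (m+1) t h := by
  ext j
  unfold Lk
  rw [← succAbove_one_last]
  simp only [Fin.succAbove_right_inj]

def bodyA (m : ℕ) (t h a : ℝ) : Set (EE (m+3)) :=
  {x | x ∈ cbox (Lk (m+2) t h) ∧ a * h ≤ h * x 0 + h * x 1 + a * x (Fin.last (m+2))}

def triT (m : ℕ) (t h a : ℝ) : Set (EE (m+2)) :=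
  {y | y ∈ cbox (Lk (m+1) t h) ∧ h * y 0 + a * y (Fin.last (m+1)) < a * h}

def psi (m : ℕ) (h a : ℝ) (y : EE (m+2)) : EE (m+3) :=
  ins 1 (a - y 0 - a / h * y (Fin.last (m+1))) y

lemma half_closed (m : ℕ) (h a : ℝ) :
    IsClosed {x : EE (m+3) | a * h ≤ h * x 0 + h * x 1 + a * x (Fin.last (m+2))} :=
  isClosed_le (by fun_prop) (by fun_prop)

lemma half_open (m : ℕ) (h a : ℝ) :
    IsOpen {x : EE (m+3) | a * h < h * x 0 + h * x 1 + a * x (Fin.last (m+2))} :=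
  isOpen_lt (by fun_prop) (by fun_prop)

lemma bodyA_closed (m : ℕ) (t h a : ℝ) : IsClosed (bodyA m t h a) :=
  (cbox_closed _).inter (half_closed m h a)

lemma bodyA_compact (m : ℕ) (t h a : ℝ) : IsCompact (bodyA m t h a) :=
  (cbox_compact _).inter_right (half_closed m h a)

lemma bodyA_convex (m : ℕ) (t h a : ℝ) : Convex ℝ (bodyA m t h a) := by
  intro x hx y hy r s hr hs hrs
  refine ⟨cbox_convex _ hx.1 hy.1 hr hs hrs, ?_⟩
  simp only [PiLp.add_apply, PiLp.smul_apply, smul_eq_mul]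
  have h1 := mul_le_mul_of_nonneg_left hx.2 hr
  have h2 := mul_le_mul_of_nonneg_left hy.2 hs
  have h3 : a * h = r * (a * h) + s * (a * h) := by rw [← add_mul, hrs, one_mul]
  rw [h3]
  linarith

lemma bodyA_int (m : ℕ) (t h a : ℝ) :
    obox (Lk (m+2) t h) ∩ {x : EE (m+3) | a * h < h * x 0 + h * x 1 + a * x (Fin.last (m+2))}
      ⊆ interior (bodyA m t h a) := by
  refine interior_maximal ?_ ((obox_open _).inter (half_open m h a))
  rintro x ⟨hx, hx'⟩
  exact ⟨fun i => ⟨(hx i).1.le, (hx i).2.le⟩, le_of_lt hx'⟩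

def GG (m : ℕ) (t h a : ℝ) (p : Fin (m+3) × Bool) : Set (EE (m+2)) :=
  open Classical in
  if p = (0, false) ∨ p = (1, false) then cbox (Lk (m+1) t h) \ triT m t h a
    else cbox (fun j => Lk (m+2) t h (p.1.succAbove j))

lemma frontier_bodyA_sub (m : ℕ) (t h a : ℝ) (hh : 0 < h) :
    frontier (bodyA m t h a) ⊆ (⋃ p : Fin (m+3) × Bool,
      ins p.1 (if p.2 then Lk (m+2) t h p.1 else 0) '' GG m t h a p) ∪
      psi m h a '' triT m t h a := by
  intro x hx
  have hxA : x ∈ bodyA m t h a := (bodyA_closed m t h a).frontier_subset hx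
  have hni : x ∉ interior (bodyA m t h a) := hx.2
  have hxc := hxA.1
  have hxs := hxA.2
  by_cases hob : x ∈ obox (Lk (m+2) t h)
  · right
    have heq : a * h = h * x 0 + h * x 1 + a * x (Fin.last (m+2)) := by
      refine le_antisymm hxs (not_lt.1 fun hlt => hni (bodyA_int m t h a ⟨hob, hlt⟩))
    refine ⟨res 1 x, ⟨fun j => ?_, ?_⟩, ?_⟩
    · rw [← Lk_one]
      exact hxc _
    · rw [res_apply, res_apply, succAbove_one_zero, succAbove_one_last]
      nlinarith [(hob 1).1]
    · conv_rhs => rw [← ins_res 1 x]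
      unfold psi
      congr 1
      rw [res_apply, res_apply, succAbove_one_zero, succAbove_one_last]
      field_simp
      linarith
  · left
    simp only [obox, mem_ofPred_eq, not_forall, not_and_or, not_lt] at hob
    obtain ⟨i, hi⟩ := hob
    have hres : res i x ∈ cbox (fun j => Lk (m+2) t h (i.succAbove j)) := fun j => hxc _
    rcases hi with hi | hi
    · have h0 : x i = 0 := le_antisymm hi (hxc i).1
      refine mem_iUnion.2 ⟨(i, false), res i x, ?_, ?_⟩
      · unfold GG
        split_ifs with hp
        · simp only [Prod.mk.injEq, and_true] at hp
          rcases hp with rfl | rfl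
          · rw [Lk_zero] at hres
            refine ⟨hres, fun hT => ?_⟩
            have := hT.2
            rw [res_apply, res_apply, succAbove_zero_zero, succAbove_zero_last] at this
            rw [h0] at hxs
            linarith
          · rw [Lk_one] at hres
            refine ⟨hres, fun hT => ?_⟩
            have := hT.2
            rw [res_apply, res_apply, succAbove_one_zero, succAbove_one_last] at this
            rw [h0] at hxs
            linarith
        · exact hres
      · conv_rhs => rw [← ins_res i x, h0]
        simp
    · have h0 : x i = Lk (m+2) t h i := le_antisymm (hxc i).2 hi
      refine mem_iUnion.2 ⟨(i, true), res i x, ?_, ?_⟩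
      · simpa [GG] using hres
      · conv_rhs => rw [← ins_res i x, h0]
        simp

/-- diagonal scaling of the first coordinate by `√2` -/
def diagD (m : ℕ) : EE (m+2) →ₗ[ℝ] EE (m+2) :=
  Matrix.toLin (EuclideanSpace.basisFun (Fin (m+2)) ℝ).toBasis
    (EuclideanSpace.basisFun (Fin (m+2)) ℝ).toBasis
    (Matrix.diagonal (fun i => if i = 0 then √2 else 1))

lemma diagD_det (m : ℕ) : LinearMap.det (diagD m) = √2 := by
  unfold diagD
  rw [LinearMap.det_toLin, Matrix.det_diagonal]
  simp

lemma diagD_apply (m : ℕ) (y : EE (m+2)) (i) :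
    diagD m y i = (if i = 0 then √2 else 1) * y i := by
  have : diagD m y = ∑ j, (Matrix.diagonal (fun i : Fin (m+2) => if i = 0 then √2 else 1)).mulVec y j
      • EuclideanSpace.basisFun (Fin (m+2)) ℝ j := by
    unfold diagD
    rw [Matrix.toLin_apply]
    rfl
  rw [this]
  simp only [Matrix.mulVec_diagonal, WithLp.ofLp_sum, Finset.sum_apply, PiLp.smul_apply,
    EuclideanSpace.basisFun_apply, PiLp.single_apply, smul_eq_mul]
  rw [Finset.sum_eq_single i]
  · simp
  · intro b _ hb
    rw [if_neg (Ne.symm hb), mul_zero]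
  · simp

def phi (m : ℕ) (h a : ℝ) (s : EE (m+2)) : EE (m+3) :=
  ins 1 (a - s 0 / √2 - a / h * s (Fin.last (m+1)))
    (WithLp.toLp 2 fun j => if j = 0 then s 0 / √2 else s j)

lemma psi_eq (m : ℕ) (h a : ℝ) (y : EE (m+2)) : psi m h a y = phi m h a (diagD m y) := by
  unfold psi phi
  have h2 : √2 ≠ 0 := by positivity
  congr 1
  · rw [diagD_apply, diagD_apply, if_pos rfl, if_neg (Fin.last_pos.ne'), one_mul,
      mul_div_cancel_left₀ _ h2]
  · ext j
    by_cases hj : j = 0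
    · subst hj
      simp [diagD_apply]
    · simp [diagD_apply, hj]

lemma phi_lip (m : ℕ) (h a : ℝ) (hh : 0 < h) (ha : 0 < a) :
    LipschitzWith (Real.toNNReal (1 + a / h)) (phi m h a) := by
  have he : 0 < a / h := by positivity
  refine LipschitzWith.of_dist_le_mul fun x y => ?_
  rw [Real.coe_toNNReal _ (by positivity), EuclideanSpace.dist_eq, EuclideanSpace.dist_eq]
  refine Real.sqrt_le_iff.2 ⟨by positivity, ?_⟩
  rw [mul_pow, Real.sq_sqrt (Finset.sum_nonneg fun i _ => by positivity),
    Fin.sum_univ_succAbove _ 1]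
  simp only [phi, ins_same, ins_succAbove, Real.dist_eq, sq_abs]
  rw [Fin.sum_univ_succ, Fin.sum_univ_succ (f := fun i => (x i - y i)^2),
    Fin.sum_univ_castSucc, Fin.sum_univ_castSucc (f := fun i : Fin (m+1) => (x i.succ - y i.succ)^2)]
  simp only [if_true, Fin.succ_ne_zero, if_false]
  have hR : 0 ≤ ∑ i : Fin m, (x i.castSucc.succ - y i.castSucc.succ)^2 :=
    Finset.sum_nonneg fun i _ => by positivity
  generalize (∑ i : Fin m, (x i.castSucc.succ - y i.castSucc.succ)^2) = R at *
  generalize a / h = e at *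
  have hs : (√2)⁻¹^2 = (1:ℝ)/2 := by rw [inv_pow, Real.sq_sqrt (by norm_num)]; norm_num
  have hs1 : (√2)⁻¹ ≤ (1:ℝ) := inv_le_one_of_one_le₀ (Real.one_le_sqrt.2 (by norm_num))
  have hs0 : 0 < (√2)⁻¹ := by positivity
  have e1 : ∀ r : ℝ, r / √2 = (√2)⁻¹ * r := fun r => by rw [div_eq_mul_inv, mul_comm]
  simp only [e1]
  generalize (√2)⁻¹ = w at *
  obtain ⟨d, hd⟩ : ∃ d, d = x 0 - y 0 := ⟨_, rfl⟩
  obtain ⟨f, hf⟩ : ∃ f, f = x (Fin.last (m+1)) - y (Fin.last (m+1)) := ⟨_, rfl⟩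
  have e2 : (a - w * x 0 - e * x (Fin.last (m+1)) - (a - w * y 0 - e * y (Fin.last (m+1)))) =
    -(w * d + e * f) := by rw [hd, hf]; ring
  have e3 : w * x 0 - w * y 0 = w * d := by rw [hd]; ring
  have e4 : (Fin.last m).succ = Fin.last (m+1) := rfl
  rw [e4, e2, e3, ← hd, ← hf]
  have k1 : 2 * w * (d * f) ≤ d^2 + f^2 := by
    nlinarith [sq_nonneg (d - f), sq_nonneg (d+f), mul_nonneg hs0.le (sq_nonneg (d-f)),
      mul_nonneg (sub_nonneg.2 hs1) (sq_nonneg d), mul_nonneg (sub_nonneg.2 hs1) (sq_nonneg f)]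
  have k2 := mul_le_mul_of_nonneg_left k1 he.le
  have k3 : (-(w*d + e*f))^2 + ((w*d)^2 + (R + f^2)) =
    2 * w^2 * d^2 + e * (2 * w * (d*f)) + e^2*f^2 + R + f^2 := by ring
  rw [k3, hs]
  nlinarith [mul_nonneg he.le hR, mul_nonneg (sq_nonneg e) hR, mul_nonneg he.le (sq_nonneg d),
    mul_nonneg he.le (sq_nonneg f), mul_nonneg (sq_nonneg e) (sq_nonneg d),
    mul_nonneg (sq_nonneg e) (sq_nonneg f)]

lemma haus_haar (k : ℕ) : (μH[(k : ℝ)] : Measure (EE k)).IsAddHaarMeasure := by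
  have := isAddHaarMeasure_hausdorffMeasure (E := EE k)
  simpa using this

lemma slant_measure (m : ℕ) (h a : ℝ) (hh : 0 < h) (ha : 0 < a) (T : Set (EE (m+2))) :
    (μH[((m+2 : ℕ) : ℝ)] : Measure (EE (m+3))) (psi m h a '' T) ≤
      ENNReal.ofReal ((1 + a/h)^(m+2) * √2) * μH[((m+2 : ℕ) : ℝ)] T := by
  have := haus_haar (m+2)
  have e : psi m h a '' T = phi m h a '' (diagD m '' T) := by
    rw [image_image]
    simp only [psi_eq]
  rw [e]
  refine ((phi_lip m h a hh ha).lipschitzOnWith.hausdorffMeasure_image_le (by positivity)).trans ?_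
  rw [Measure.addHaar_image_linearMap, diagD_det, ENNReal.ofReal_mul (by positivity), mul_assoc,
    abs_of_pos (by positivity), ENNReal.rpow_natCast, ENNReal.ofReal_pow (by positivity)]
  rfl

lemma facet_prod (m : ℕ) (t h : ℝ) (ht : 0 < t) (i : Fin (m+3)) :
    ∏ j, Lk (m+2) t h (i.succAbove j) = if i = Fin.last (m+2) then t^(m+2) else t^(m+1) * h := by
  split_ifs with hi
  · subst hi
    simp [Lk, Fin.castSucc_ne_last]
  · have h1 := Fin.prod_univ_succAbove (Lk (m+2) t h) i
    rw [Lk_prod] at h1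
    have h2 : Lk (m+2) t h i = t := by simp [Lk, hi]
    rw [h2] at h1
    refine mul_left_cancel₀ ht.ne' ?_
    rw [← h1]
    ring

lemma facet_sum (m : ℕ) (t h q : ℝ) (ht : 0 < t) :
    ∑ i : Fin (m+3), 2 * (q * ∏ j, Lk (m+2) t h (i.succAbove j)) =
      2 * q * ((m+2) * (t^(m+1) * h) + t^(m+2)) := by
  simp only [facet_prod m t h ht]
  rw [Fin.sum_univ_castSucc]
  simp [Fin.castSucc_ne_last]
  ring

lemma triT_meas (m : ℕ) (t h a : ℝ) : MeasurableSet (triT m t h a) := by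
  have h1 : MeasurableSet {y : EE (m+2) | h * y 0 + a * y (Fin.last (m+1)) < a * h} :=
    (isOpen_lt (by fun_prop) (by fun_prop)).measurableSet
  exact (cbox_closed _).measurableSet.inter h1

lemma surfA (m : ℕ) (t h a q : ℝ) (ht : 0 < t) (hh : 0 < h) (ha : 0 < a) (hat : a ≤ t) (hq : 0 < q)
    (h1 : ∀ l : Fin (m+2) → ℝ, (∀ i, 0 ≤ l i) →
      (μH[((m+2 : ℕ) : ℝ)] : Measure (EE (m+2))) (cbox l) = ENNReal.ofReal (q * ∏ i, l i))
    (h2 : ∀ l : Fin (m+2) → ℝ, (∀ i, 0 ≤ l i) →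
      (μH[((m+2 : ℕ) : ℝ)] : Measure (EE (m+2))) (obox l) = ENNReal.ofReal (q * ∏ i, l i)) :
    ∃ v : ℝ, q * (a * h * t^m / 4) ≤ v ∧ v ≤ q * (t^(m+1) * h) ∧
      (μH[((m+2 : ℕ) : ℝ)] : Measure (EE (m+3))) (frontier (bodyA m t h a)) ≤
      ENNReal.ofReal (2 * q * ((m+2) * (t^(m+1) * h) + t^(m+2)) - 2 * v
        + (1 + a/h)^(m+2) * √2 * v) := by
  have hbox := h1 (Lk (m+1) t h) (fun i => (Lk_pos _ ht hh i).le)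
  rw [Lk_prod] at hbox
  have hTle : (μH[((m+2 : ℕ) : ℝ)] : Measure (EE (m+2))) (triT m t h a) ≤
      ENNReal.ofReal (q * (t^(m+1) * h)) := by
    rw [← hbox]
    exact measure_mono fun y hy => hy.1
  have hTfin : (μH[((m+2 : ℕ) : ℝ)] : Measure (EE (m+2))) (triT m t h a) ≠ ∞ :=
    ne_top_of_le_ne_top ENNReal.ofReal_ne_top hTle
  obtain ⟨v, hv0, hv⟩ : ∃ v : ℝ, 0 ≤ v ∧
      (μH[((m+2 : ℕ) : ℝ)] : Measure (EE (m+2))) (triT m t h a) = ENNReal.ofReal v :=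
    ⟨_, ENNReal.toReal_nonneg, (ENNReal.ofReal_toReal hTfin).symm⟩
  rw [hv] at hTle
  have hvle : v ≤ q * (t^(m+1) * h) := (ENNReal.ofReal_le_ofReal_iff (by positivity)).1 hTle
  refine ⟨v, ?_, hvle, ?_⟩
  · rw [← ENNReal.ofReal_le_ofReal_iff hv0, ← hv]
    set l : Fin (m+2) → ℝ := fun i => if i = Fin.last (m+1) then h/2 else if i = 0 then a/2 else t
      with hl
    have hlp : ∏ i, l i = a * h * t^m / 4 := by
      have f1 : ∀ x : Fin m, l x.succ.castSucc = t := fun x => by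
        simp only [hl]
        rw [if_neg (Fin.castSucc_ne_last _), if_neg (by simp [Fin.ext_iff])]
      have f2 : l (0 : Fin (m+1)).castSucc = a / 2 := by
        simp only [hl]
        rw [if_neg (Fin.castSucc_ne_last _), if_pos (by simp)]
      have f3 : l (Fin.last (m+1)) = h / 2 := by simp [hl]
      rw [Fin.prod_univ_castSucc, Fin.prod_univ_succ, f2, f3]
      simp only [f1, Finset.prod_const, Finset.card_univ, Fintype.card_fin]
      ring
    rw [← hlp, ← h2 l (fun i => by simp only [hl]; split_ifs <;> positivity)]
    refine measure_mono fun y hy => ⟨fun i => ⟨(hy i).1.le, (hy i).2.le.trans ?_⟩, ?_⟩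
    · simp only [hl, Lk]
      split_ifs <;> linarith
    · have e1 := (hy 0).2
      have e2 := (hy (Fin.last (m+1))).2
      have e3 : l 0 = a/2 := by simp [hl, Fin.last_pos.ne]
      have e4 : l (Fin.last (m+1)) = h/2 := by simp [hl]
      rw [e3] at e1
      rw [e4] at e2
      nlinarith
  · refine (measure_mono (frontier_bodyA_sub m t h a hh)).trans ((measure_union_le _ _).trans ?_)
    have hw : ENNReal.ofReal (2 * q * ((m+2) * (t^(m+1) * h) + t^(m+2)) - 2 * v
        + (1 + a/h)^(m+2) * √2 * v) =
        ENNReal.ofReal (2 * q * ((m+2) * (t^(m+1) * h) + t^(m+2)) - 2 * v) +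
        ENNReal.ofReal ((1 + a/h)^(m+2) * √2 * v) := by
      refine ENNReal.ofReal_add ?_ (by positivity)
      have : 0 ≤ (m:ℝ) * (q * (t^(m+1) * h)) := by positivity
      have : 0 ≤ q * t^(m+2) := by positivity
      have : 0 < q * (t^(m+1) * h) := by positivity
      nlinarith
    rw [hw]
    refine add_le_add ?_ ?_
    · refine (measure_iUnion_fintype_le _ _).trans ?_
      set g : Fin (m+3) × Bool → ℝ := fun p => q * (∏ j, Lk (m+2) t h (p.1.succAbove j)) -
        if p = (0, false) ∨ p = (1, false) then v else 0 with hg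
      have hne0 : (0 : Fin (m+3)) ≠ Fin.last (m+2) := Fin.last_pos.ne
      have hne1 : (1 : Fin (m+3)) ≠ Fin.last (m+2) := by simp [Fin.ext_iff]
      have hg0 : ∀ p, 0 ≤ g p := by
        intro p
        simp only [hg, facet_prod m t h ht]
        by_cases hp : p = (0, false) ∨ p = (1, false)
        · rw [if_pos hp]
          rcases hp with rfl | rfl
          · rw [if_neg hne0]; linarith
          · rw [if_neg hne1]; linarith
        · rw [if_neg hp]
          split_ifs <;> simp <;> positivity
      have hgs : ∑ p, g p = 2 * q * ((m+2) * (t^(m+1) * h) + t^(m+2)) - 2 * v := by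
        rw [← facet_sum m t h q ht]
        simp only [hg]
        rw [Finset.sum_sub_distrib]
        congr 1
        · rw [Fintype.sum_prod_type]
          simp [two_mul]
        · rw [← Finset.sum_filter]
          have : (Finset.univ.filter fun p : Fin (m+3) × Bool => p = (0, false) ∨ p = (1, false))
            = {(0, false), (1, false)} := by
            ext p; simp
          rw [this, Finset.sum_pair (by simp)]
          ring
      rw [← hgs, ENNReal.ofReal_sum_of_nonneg (fun p _ => hg0 p)]
      refine Finset.sum_le_sum fun p _ => ?_
      rw [facet_measure]
      simp only [GG, hg]
      by_cases hp : p = (0, false) ∨ p = (1, false)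
      · rw [if_pos hp, if_pos hp, measure_sdiff (fun y hy => hy.1) (triT_meas m t h a).nullMeasurableSet hTfin,
          hbox, hv, ← ENNReal.ofReal_sub _ hv0, facet_prod m t h ht]
        rcases hp with rfl | rfl
        · rw [if_neg hne0]
        · rw [if_neg hne1]
      · rw [if_neg hp, if_neg hp, h1 _ (fun j => (Lk_pos _ ht hh _).le), sub_zero]
    · refine (slant_measure m h a hh ha _).trans ?_
      rw [hv, ← ENNReal.ofReal_mul (by positivity)]

lemma volA (m : ℕ) (t h a p : ℝ) (ht : 0 < t) (hh : 0 < h) (ha : 0 < a)  (hp : 0 < p)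
    (h1 : ∀ l : Fin (m+3) → ℝ, (∀ i, 0 ≤ l i) →
      (μH[((m+3 : ℕ) : ℝ)] : Measure (EE (m+3))) (cbox l) = ENNReal.ofReal (p * ∏ i, l i)) :
    ENNReal.ofReal (p * (t^(m+2) * h) - p * (a^2 * t^m * h)) ≤
      (μH[((m+3 : ℕ) : ℝ)] : Measure (EE (m+3))) (bodyA m t h a) := by
  set l : Fin (m+3) → ℝ := fun i => if i = Fin.last (m+2) then h else
    if i = 0 then a else if i = 1 then a else t with hl
  have hlp : ∏ i, l i = a^2 * t^m * h := by
    have f1 : ∀ x : Fin m, l x.succ.succ.castSucc = t := fun x => by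
      simp only [hl]
      rw [if_neg (Fin.castSucc_ne_last _), if_neg (by simp [Fin.ext_iff]),
        if_neg (by simp [Fin.ext_iff])]
    have f2 : l (0 : Fin (m+2)).castSucc = a := by
      simp only [hl]
      rw [if_neg (Fin.castSucc_ne_last _), if_pos (by simp)]
    have f4 : l (0 : Fin (m+1)).succ.castSucc = a := by
      simp only [hl]
      rw [if_neg (Fin.castSucc_ne_last _), if_neg (by simp [Fin.ext_iff]), if_pos (by simp)]
    have f3 : l (Fin.last (m+2)) = h := by simp [hl]
    rw [Fin.prod_univ_castSucc, Fin.prod_univ_succ, Fin.prod_univ_succ, f2, f3, f4]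
    simp only [f1, Finset.prod_const, Finset.card_univ, Fintype.card_fin]
    ring
  rw [ENNReal.ofReal_sub _ (by positivity), ← hlp, ← Lk_prod,
    ← h1 l (fun i => by simp only [hl]; split_ifs <;> positivity),
    ← h1 _ (fun i => (Lk_pos _ ht hh i).le)]
  refine (le_measure_sdiff).trans (measure_mono ?_)
  rintro x ⟨hx, hx'⟩
  refine ⟨hx, ?_⟩
  by_contra hlt
  push Not at hlt
  refine hx' fun i => ⟨(hx i).1, ?_⟩
  have p0 := (hx 0).1
  have p1 := (hx 1).1
  have p2 := (hx (Fin.last (m+2))).1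
  have p3 := mul_nonneg ha.le p2
  have key := (hx i).2
  simp only [hl]
  simp only [Lk] at key
  split_ifs with c1 c2 c3
  · simpa [c1] using key
  · subst c2
    by_contra hc
    push Not at hc
    nlinarith [mul_nonneg hh.le p1]
  · subst c3
    by_contra hc
    push Not at hc
    nlinarith [mul_nonneg hh.le p0]
  · simpa [c1] using key

lemma cyl_eq (k : ℕ) (t h : ℝ) (hh : 0 ≤ h) :
    cbox (Lk k t 0) + segment ℝ 0 (h • (EuclideanSpace.single (Fin.last k) (1:ℝ) : EE (k+1))) =
      cbox (Lk k t h) := by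
  ext x
  rw [Set.mem_add]
  constructor
  · rintro ⟨y, hy, z, hz, rfl⟩ i
    rw [segment_eq_image] at hz
    obtain ⟨s, hs, rfl⟩ := hz
    have hyi := hy i
    simp only [Lk] at hyi ⊢
    by_cases hi : i = Fin.last k
    · subst hi
      simp only [if_true] at hyi ⊢
      have h0 : y (Fin.last k) = 0 := le_antisymm hyi.2 hyi.1
      simp [h0]
      exact ⟨mul_nonneg hs.1 hh, mul_le_of_le_one_left hh hs.2⟩
    · simp only [hi, if_false] at hyi ⊢
      simpa [hi] using hyi
  · intro hx
    refine ⟨x - x (Fin.last k) • EuclideanSpace.single (Fin.last k) (1:ℝ), ?_,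
      x (Fin.last k) • EuclideanSpace.single (Fin.last k) (1:ℝ), ?_, by simp⟩
    · intro i
      have hxi := hx i
      simp only [Lk] at hxi ⊢
      by_cases hi : i = Fin.last k
      · subst hi
        simp
      · simp only [hi, if_false] at hxi ⊢
        simpa [hi] using hxi
    · have hxl := hx (Fin.last k)
      simp only [Lk, if_true] at hxl
      rw [segment_eq_image]
      rcases hh.eq_or_lt with rfl | hpos
      · have h0 : x (Fin.last k) = 0 := le_antisymm hxl.2 hxl.1
        exact ⟨0, by simp, by simp [h0]⟩
      · refine ⟨x (Fin.last k) / h, ⟨div_nonneg hxl.1 hh, (div_le_one hpos).2 hxl.2⟩, ?_⟩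
        simp only [smul_zero, zero_add, smul_smul]
        rw [div_mul_cancel₀ _ hpos.ne']

lemma dir_finrank (k : ℕ) (t : ℝ) (ht : 0 < t) :
    Module.finrank ℝ (affineSpan ℝ (cbox (Lk k t 0))).direction = k := by
  have key : (affineSpan ℝ (cbox (Lk k t 0))).direction =
      (Submodule.span ℝ {(EuclideanSpace.single (Fin.last k) (1:ℝ) : EE (k+1))})ᗮ := by
    rw [direction_affineSpan]
    apply le_antisymm
    · rw [vectorSpan_def, Submodule.span_le]
      rintro _ ⟨x, hx, y, hy, rfl⟩
      have h1 := hx (Fin.last k)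
      have h2 := hy (Fin.last k)
      simp only [Lk, if_true] at h1 h2
      simp only [SetLike.mem_coe, Submodule.mem_orthogonal_singleton_iff_inner_left]
      have e1 := le_antisymm h1.2 h1.1
      have e2 := le_antisymm h2.2 h2.1
      simp [EuclideanSpace.inner_single_right, e1, e2]
    · intro w hw
      rw [Submodule.mem_orthogonal_singleton_iff_inner_left] at hw
      have hw0 : w (Fin.last k) = 0 := by
        simpa [EuclideanSpace.inner_single_right] using hw
      have hsum : w = ∑ i, w i • (EuclideanSpace.single i (1:ℝ) : EE (k+1)) := by
        have := (EuclideanSpace.basisFun (Fin (k+1)) ℝ).sum_repr w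
        simpa using this.symm
      rw [hsum]
      refine Submodule.sum_mem _ fun i _ => ?_
      by_cases hi : i = Fin.last k
      · subst hi
        rw [hw0, zero_smul]
        exact Submodule.zero_mem _
      · have h0 : (0 : EE (k+1)) ∈ cbox (Lk k t 0) := by
          intro j
          simp only [Lk]
          split_ifs <;> simp [ht.le]
        have h1 : (t • (EuclideanSpace.single i (1:ℝ) : EE (k+1))) ∈ cbox (Lk k t 0) := by
          intro j
          simp only [Lk]
          by_cases hj : j = i
          · subst hj
            simp [hi, ht.le]
          · simp [hj]
            split_ifs <;> simp [ht.le]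
        have h2 := vsub_mem_vectorSpan ℝ h1 h0
        have h3 := Submodule.smul_mem _ (w i / t) h2
        simp only [vsub_eq_sub, sub_zero, smul_smul] at h3
        rwa [div_mul_cancel₀ _ ht.ne'] at h3
  rw [key]
  have : Fact (Module.finrank ℝ (EE (k+1)) = k + 1) := ⟨by simp⟩
  apply Submodule.finrank_orthogonal_span_singleton
  intro h
  have := congrArg (fun x : EE (k+1) => x (Fin.last k)) h
  simp at this

lemma proj_eq (m : ℕ) (t h a : ℝ) (hh : 0 < h) :
    projPerp (EuclideanSpace.single (Fin.last (m+2)) (1:ℝ)) (bodyA m t h a) =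
      cbox (Lk (m+2) t 0) := by
  ext x
  constructor
  · rintro ⟨y, hy, rfl⟩ i
    have hyi := hy.1 i
    simp only [Lk] at hyi ⊢
    by_cases hi : i = Fin.last (m+2)
    · subst hi
      simp [EuclideanSpace.inner_single_right]
    · simp only [hi, if_false] at hyi ⊢
      simpa [EuclideanSpace.inner_single_right, hi] using hyi
  · intro hx
    have h0 : x (Fin.last (m+2)) = 0 := by
      have := hx (Fin.last (m+2))
      simp only [Lk, if_true] at this
      exact le_antisymm this.2 this.1
    refine ⟨x + h • EuclideanSpace.single (Fin.last (m+2)) (1:ℝ), ⟨fun i => ?_, ?_⟩, ?_⟩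
    · have hxi := hx i
      simp only [Lk] at hxi ⊢
      by_cases hi : i = Fin.last (m+2)
      · subst hi
        simp [h0, hh.le]
      · simp only [hi, if_false] at hxi ⊢
        simpa [hi] using hxi
    · have e0 := (hx 0).1
      have e1 := (hx 1).1
      have hne0 : (0 : Fin (m+3)) ≠ Fin.last (m+2) := Fin.last_pos.ne
      have hne1 : (1 : Fin (m+3)) ≠ Fin.last (m+2) := by simp [Fin.ext_iff]
      simp [h0, hne0, hne1]
      nlinarith [mul_nonneg hh.le e0, mul_nonneg hh.le e1]
    · ext i
      simp [EuclideanSpace.inner_single_right, h0]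

lemma pow_bound (k : ℕ) (e : ℝ) (he : 0 ≤ e) (hk : k * e ≤ 1/100) : (1 + e)^k * √2 ≤ 3/2 := by
  rcases Nat.eq_zero_or_pos k with rfl | hkp
  · have : √2 ≤ 3/2 := Real.sqrt_le_iff.2 ⟨by norm_num, by norm_num⟩
    simpa using this
  have hk1 : (1:ℝ) ≤ k := by exact_mod_cast hkp
  have he1 : e ≤ 1/100 := by nlinarith
  have h1 := one_add_mul_le_pow (a := -e) (by linarith) k
  have h2 : (1+e)^k * (1 + -e)^k ≤ 1 := by
    rw [← mul_pow]
    exact pow_le_one₀ (by nlinarith) (by nlinarith)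
  have hP : 0 < (1+e)^k := by positivity
  have h3 : (1+e)^k * (99/100) ≤ 1 := by
    refine le_trans ?_ h2
    gcongr
    linarith
  have h4 : √2 ≤ 1415/1000 := Real.sqrt_le_iff.2 ⟨by norm_num, by norm_num⟩
  have h5 : (1+e)^k ≤ 100/99 := by linarith
  calc (1+e)^k * √2 ≤ 100/99 * (1415/1000) := by gcongr
    _ ≤ 3/2 := by norm_num

theorem stmt13 (n : ℕ) (hn : 3 ≤ n)
    (u : EuclideanSpace ℝ (Fin n))
    (hu : u = EuclideanSpace.single (⟨n - 1, by omega⟩ : Fin n) 1) :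
    ∃ C A : Set (EuclideanSpace ℝ (Fin n)),
      IsCompact C ∧ Convex ℝ C ∧ (∀ x ∈ C, ⟪x, u⟫ = 0) ∧
      Module.finrank ℝ (affineSpan ℝ C).direction = n - 1 ∧
      IsCompact A ∧ Convex ℝ A ∧ (interior A).Nonempty ∧ projPerp u A = C ∧
      ((2 * ((n : ℝ≥0∞) - 1))⁻¹ < μH[(n : ℝ)] A / μH[(n : ℝ) - 1] (frontier A)) ∧
      Tendsto
        (fun h : ℝ =>
          μH[(n : ℝ)] (C + segment ℝ 0 (h • u)) /
            μH[(n : ℝ) - 1] (frontier (C + segment ℝ 0 (h • u))))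
        atTop (nhds ((2 * ((n : ℝ≥0∞) - 1))⁻¹)) := by
  obtain ⟨m, rfl⟩ := Nat.exists_eq_add_of_le' hn
  have hu' : u = EuclideanSpace.single (Fin.last (m+2)) (1:ℝ) := hu
  clear hu
  subst hu'
  obtain ⟨q, hq, hq1, hq2⟩ := haus (m+2)
  obtain ⟨p, hp, hp1, hp2⟩ := haus (m+3)
  have hdim : ((m+3 : ℕ) : ℝ) - 1 = ((m+2 : ℕ) : ℝ) := by push_cast; ring
  have hlim : (2 * (((m+3 : ℕ) : ℝ≥0∞) - 1))⁻¹ = ENNReal.ofReal (1 / (2 * ((m:ℝ)+2))) := by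
    have h1 : ((m+3 : ℕ) : ℝ≥0∞) - 1 = ((m+2 : ℕ) : ℝ≥0∞) := by
      have : ((m+3 : ℕ) : ℝ≥0∞) = ((m+2 : ℕ) : ℝ≥0∞) + 1 := by push_cast; ring
      rw [this]
      exact ENNReal.add_sub_cancel_right ENNReal.one_ne_top
    rw [h1, one_div, ENNReal.ofReal_inv_of_pos (by positivity), ENNReal.ofReal_mul (by norm_num)]
    congr 2
    · simp
    · rw [← ENNReal.ofReal_natCast]
      push_cast
      rfl
  rw [hdim, hlim]
  obtain ⟨t, htp⟩ : ∃ t, t = q / p := ⟨_, rfl⟩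
  have ht : 0 < t := by rw [htp]; positivity
  have hpt : p * t = q := by rw [htp]; field_simp
  set N : ℝ := (m:ℝ) + 3 with hN
  have hm0 : (0:ℝ) ≤ m := Nat.cast_nonneg m
  have hNp : 0 < N := by positivity
  obtain ⟨a, ha⟩ : ∃ a, a = t / (32 * N) := ⟨_, rfl⟩
  obtain ⟨h, hh⟩ : ∃ h, h = 2000 * N * t := ⟨_, rfl⟩
  have hap : 0 < a := by rw [ha]; positivity
  have hhp : 0 < h := by rw [hh]; positivity
  have hat : a ≤ t := by
    rw [ha]
    exact div_le_self ht.le (by linarith)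
  have hne0 : (0 : Fin (m+3)) ≠ Fin.last (m+2) := Fin.last_pos.ne
  have hne1 : (1 : Fin (m+3)) ≠ Fin.last (m+2) := by simp [Fin.ext_iff]
  refine ⟨cbox (Lk (m+2) t 0), bodyA m t h a, cbox_compact _, cbox_convex _, ?_, ?_,
    bodyA_compact _ _ _ _, bodyA_convex _ _ _ _, ?_, proj_eq m t h a hhp, ?_, ?_⟩
  · intro x hx
    have := hx (Fin.last (m+2))
    simp only [Lk, if_true] at this
    simpa [EuclideanSpace.inner_single_right] using le_antisymm this.2 this.1
  · exact dir_finrank (m+2) t ht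
  · refine ⟨WithLp.toLp 2 fun i => Lk (m+2) t h i / 2, bodyA_int m t h a ⟨fun i => ?_, ?_⟩⟩
    · have := Lk_pos (m+2) ht hhp i
      constructor
      · simp only; linarith
      · simp only; linarith
    · simp only [mem_ofPred_eq, Lk, if_neg hne0, if_neg hne1, if_true]
      nlinarith [mul_le_mul_of_nonneg_left hat hhp.le, mul_pos hap hhp]
  · obtain ⟨v, hv1, hv2, hS⟩ := surfA m t h a q ht hhp hap hat hq hq1 hq2
    have hV := volA m t h a p ht hhp hap hp hp1
    have hpow : (1 + a/h)^(m+2) * √2 ≤ 3/2 := by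
      apply pow_bound _ _ (by positivity)
      have e1 : a / h = 1 / (64000 * N^2) := by
        rw [ha, hh]
        field_simp
        norm_num
      rw [e1]
      push_cast
      rw [mul_one_div, div_le_div_iff₀ (by positivity) (by norm_num)]
      nlinarith
    have hP0 : 0 < (1 + a/h)^(m+2) * √2 := by positivity
    generalize (1 + a/h)^(m+2) * √2 = P at *
    have hX : 0 < q * t^(m+2) := by positivity
    obtain ⟨X, hXd⟩ : ∃ X, X = q * t^(m+2) := ⟨_, rfl⟩
    have e1 : q * (a * h * t^m / 4) = X * (2000 / 128) := by
      rw [hXd, ha, hh]; field_simp; ring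
    have e2 : q * (t^(m+1) * h) = X * (2000 * N) := by
      rw [hXd, hh]; ring
    have e3 : p * (t^(m+2) * h) - p * (a^2 * t^m * h) = X * (2000 * N - 2000 / (1024 * N)) := by
      rw [hXd, ← hpt, ha, hh]; field_simp; ring
    have e4 : 2 * q * (((m:ℝ)+2) * (t^(m+1) * h) + t^(m+2)) - 2 * v + P * v =
        2 * (m+2) * (X * (2000 * N)) + 2 * X - 2 * v + P * v := by
      rw [← e2, hXd]; ring
    rw [e4] at hS
    rw [e3] at hV
    rw [e1] at hv1
    rw [e2] at hv2
    rw [← hXd] at hX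
    have hv0 : 0 < v := lt_of_lt_of_le (by positivity) hv1
    have hPv : P * v ≤ 3/2 * v := mul_le_mul_of_nonneg_right hpow hv0.le
    have hPv0 : 0 < P * v := mul_pos hP0 hv0
    generalize P * v = Y at *
    have hSp : 0 < 2 * ((m:ℝ)+2) * (X * (2000 * N)) + 2 * X - 2 * v + Y := by
      have : 0 < X * (2000 * N) := by positivity
      nlinarith [mul_nonneg hm0 this.le]
    have hfin : 2 * ((m:ℝ)+2) * (X * (2000 * N)) + 2 * X - 2 * v + Y <
        (X * (2000 * N - 2000 / (1024 * N))) * (2 * ((m:ℝ)+2)) := by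
      have hk : X * (2000 / (1024 * N)) * (2 * ((m:ℝ)+2)) ≤ X * (4000/1024) := by
        have : (2000 / (1024 * N)) * (2 * ((m:ℝ)+2)) ≤ 4000/1024 := by
          rw [div_mul_eq_mul_div, div_le_div_iff₀ (by positivity) (by norm_num), hN]
          nlinarith
        calc _ = X * ((2000 / (1024 * N)) * (2 * ((m:ℝ)+2))) := by ring
          _ ≤ _ := by gcongr
      nlinarith
    refine lt_of_lt_of_le ?_ (ENNReal.div_le_div hV hS)
    rw [← ENNReal.ofReal_div_of_pos hSp]
    refine (ENNReal.ofReal_lt_ofReal_iff_of_nonneg (by positivity)).2 ?_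
    rw [div_lt_div_iff₀ (by positivity) hSp]
    linarith
  · have hreal : Tendsto (fun h : ℝ => 1 / (2 * ((m:ℝ)+2) + 2 * t / h)) atTop
        (nhds (1 / (2 * ((m:ℝ)+2)))) := by
      have h1 : Tendsto (fun h : ℝ => 2 * ((m:ℝ)+2) + 2 * t / h) atTop
          (nhds (2 * ((m:ℝ)+2) + 0)) :=
        tendsto_const_nhds.add (tendsto_const_nhds.div_atTop tendsto_id)
      rw [add_zero] at h1
      exact tendsto_const_nhds.div h1 (by positivity)
    refine (ENNReal.tendsto_ofReal hreal).congr' ?_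
    filter_upwards [eventually_gt_atTop 0] with h hh
    rw [cyl_eq (m+2) t h hh.le, hp1 _ (fun i => (Lk_pos _ ht hh i).le), Lk_prod,
      frontier_cbox_measure _ (Lk_pos (m+2) ht hh) q hq hq1 hq2, facet_sum m t h q ht,
      ← ENNReal.ofReal_div_of_pos (by positivity)]
    congr 1
    rw [← hpt]
    field_simp
    ring
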